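/- Let C be the W-characteristic set of ⟨P⟩. For any 0 ≤ i ≤ n, if C^{⟨0,…,i⟩} = [C_1,…,C_k] is a regular set, then [C_1, prem(C_2,[C_1]), …, prem(C_k,[C_1,…,C_{k−1}])] is a Ritt characteristic set of the elimination ideal ⟨P⟩ ∩ k[x_1,…,x_i]. -/

import Mathlib

open MvPolynomial

namespace CharSets

variable {n : ℕ} {K : Type*} [Field K]

/-- The coefficient of `x_i ^ d` in `F`, as a polynomial in the remaining variables. -/
noncomputable def coefv (i : Fin n) (d : ℕ) (F : MvPolynomial (Fin n) K) :
    MvPolynomial (Fin n) K :=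
  ∑ m ∈ F.support.filter (fun m => m i = d), monomial (Finsupp.erase i m) (F.coeff m)

/-- The leading coefficient of `F` with respect to the variable `x_i`. -/
noncomputable def lcv (i : Fin n) (F : MvPolynomial (Fin n) K) : MvPolynomial (Fin n) K :=
  coefv i (F.degreeOf i) F

/-- Auxiliary pseudo-division: computes (pseudo-quotient, pseudo-remainder) pairs,
with the first argument as fuel; the total power of the leading coefficient used is
exactly the fuel, so that starting with fuel `max(l - m + 1, 0)` yields the pair
`(Q, R)` of the unique representation `lc(F,x_i)^q • G = Q*F + R` with
`q = max(l - m + 1, 0)` and `deg(R, x_i) < deg(F, x_i)`. -/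
noncomputable def pdivAux (i : Fin n) (F : MvPolynomial (Fin n) K) :
    ℕ → MvPolynomial (Fin n) K × MvPolynomial (Fin n) K →
      MvPolynomial (Fin n) K × MvPolynomial (Fin n) K
  | 0, QR => QR
  | q + 1, QR =>
    if (QR.2).degreeOf i < F.degreeOf i then
      (lcv i F ^ (q + 1) * QR.1, lcv i F ^ (q + 1) * QR.2)
    else
      pdivAux i F q
        (lcv i F * QR.1 +
            coefv i ((QR.2).degreeOf i) QR.2 * X i ^ ((QR.2).degreeOf i - F.degreeOf i),
          lcv i F * QR.2 -
            coefv i ((QR.2).degreeOf i) QR.2 * X i ^ ((QR.2).degreeOf i - F.degreeOf i) * F)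

/-- The pseudo-remainder `prem(G, F, x_i)`. -/
noncomputable def prem (G F : MvPolynomial (Fin n) K) (i : Fin n) : MvPolynomial (Fin n) K :=
  (pdivAux i F (G.degreeOf i + 1 - F.degreeOf i) (0, G)).2

/-- The pseudo-quotient `pquo(G, F, x_i)`. -/
noncomputable def pquo (G F : MvPolynomial (Fin n) K) (i : Fin n) : MvPolynomial (Fin n) K :=
  (pdivAux i F (G.degreeOf i + 1 - F.degreeOf i) (0, G)).1

/-- The class of `P`: the largest index (1-based) of a variable actually occurring in `P`;
the class of a constant is `0`. -/
noncomputable def cls (P : MvPolynomial (Fin n) K) : ℕ :=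
  P.vars.sup fun i => (i : ℕ) + 1

/-- The degree of `G` in the leading variable of `P` (`0` if `P` is constant). -/
noncomputable def degLv (G P : MvPolynomial (Fin n) K) : ℕ :=
  if h : P.vars.Nonempty then G.degreeOf (P.vars.max' h) else 0

/-- `G` is R-reduced with respect to `P`, i.e. `deg(G, lv(P)) < deg(P, lv(P))`. -/
def RReduced (G P : MvPolynomial (Fin n) K) : Prop :=
  degLv G P < degLv P P

/-- The initial of `P`: its leading coefficient w.r.t. its leading variable. -/
noncomputable def ini (P : MvPolynomial (Fin n) K) : MvPolynomial (Fin n) K :=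
  if h : P.vars.Nonempty then lcv (P.vars.max' h) P else P

/-- Pseudo-remainder of `G` w.r.t. `F` in the leading variable of `F`
(in case `F` is constant, `m = 0` and the pseudo-remainder is `0`). -/
noncomputable def premLv (G F : MvPolynomial (Fin n) K) : MvPolynomial (Fin n) K :=
  if h : F.vars.Nonempty then prem G F (F.vars.max' h) else 0

/-- Pseudo-quotient of `G` w.r.t. `F` in the leading variable of `F`. -/
noncomputable def pquoLv (G F : MvPolynomial (Fin n) K) : MvPolynomial (Fin n) K :=
  if h : F.vars.Nonempty then pquo G F (F.vars.max' h) else 0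

/-- Iterated pseudo-remainder with respect to a triangular set `[T_1, …, T_r]`:
`prem(P, T) = prem(⋯prem(P, T_r, lv(T_r)), …, T_1, lv(T_1))`. -/
noncomputable def premTS (P : MvPolynomial (Fin n) K) (L : List (MvPolynomial (Fin n) K)) :
    MvPolynomial (Fin n) K :=
  L.foldr (fun T acc => premLv acc T) P

/-- The Sylvester matrix of `F` and `G` with respect to the variable `x_i`. -/
noncomputable def sylvester (i : Fin n) (F G : MvPolynomial (Fin n) K) :
    Matrix (Fin (G.degreeOf i + F.degreeOf i)) (Fin (G.degreeOf i + F.degreeOf i))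
      (MvPolynomial (Fin n) K) :=
  Matrix.of fun r c =>
    if (r : ℕ) < G.degreeOf i then
      if (r : ℕ) ≤ (c : ℕ) ∧ (c : ℕ) ≤ (r : ℕ) + F.degreeOf i then
        coefv i (F.degreeOf i + (r : ℕ) - (c : ℕ)) F
      else 0
    else
      if (r : ℕ) - G.degreeOf i ≤ (c : ℕ) ∧ (c : ℕ) ≤ (r : ℕ) then
        coefv i (G.degreeOf i + ((r : ℕ) - G.degreeOf i) - (c : ℕ)) G
      else 0

/-- The resultant `res(F, G, x_i)` of `F` and `G` w.r.t. `x_i`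
(the determinant of the Sylvester matrix). -/
noncomputable def resv (F G : MvPolynomial (Fin n) K) (i : Fin n) : MvPolynomial (Fin n) K :=
  (sylvester i F G).det

/-- Resultant of `F` and `G` w.r.t. the leading variable of `G`. -/
noncomputable def resLv (F G : MvPolynomial (Fin n) K) : MvPolynomial (Fin n) K :=
  if h : G.vars.Nonempty then resv F G (G.vars.max' h) else F

/-- Iterated resultant with respect to a triangular set:
`res(F, T) = res(⋯res(F, T_r, lv(T_r)), …, T_1, lv(T_1))`. -/
noncomputable def resTS (F : MvPolynomial (Fin n) K) (L : List (MvPolynomial (Fin n) K)) :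
    MvPolynomial (Fin n) K :=
  L.foldr (fun T acc => resLv acc T) F

/-- A triangular set: a nonempty ordered set of nonconstant polynomials with
strictly increasing classes. -/
def TriangularSet (L : List (MvPolynomial (Fin n) K)) : Prop :=
  L ≠ [] ∧ (∀ T ∈ L, 0 < cls T) ∧ L.Chain' fun A B => cls A < cls B

/-- An ascending set: either a single nonzero constant, or a triangular set in which
every later element is R-reduced with respect to every earlier one. -/
def AscendingSet (L : List (MvPolynomial (Fin n) K)) : Prop :=
  (∃ a : K, a ≠ 0 ∧ L = [MvPolynomial.C a]) ∨
    (TriangularSet L ∧ L.Pairwise fun A B => RReduced B A)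

/-- `F` has lower rank than `G`. -/
def rkLT (F G : MvPolynomial (Fin n) K) : Prop :=
  cls F < cls G ∨ (cls F = cls G ∧ 0 < cls F ∧ degLv F F < degLv G G)

/-- `F` and `G` have the same rank: neither has lower rank than the other. -/
def rkEQ (F G : MvPolynomial (Fin n) K) : Prop :=
  ¬ rkLT F G ∧ ¬ rkLT G F

/-- `B` has lower rank than `A` (as ascending sets). -/
def ascLT (B A : List (MvPolynomial (Fin n) K)) : Prop :=
  (∃ j, j < min A.length B.length ∧
      (∀ i, i < j → rkEQ (A.getD i 0) (B.getD i 0)) ∧ rkLT (B.getD j 0) (A.getD j 0)) ∨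
    (A.length < B.length ∧ ∀ i, i < A.length → rkEQ (A.getD i 0) (B.getD i 0))

/-- A Ritt characteristic set of the ideal `I`: an ascending set contained in `I`
of minimal rank among all ascending sets contained in `I`. -/
def RittCharSet (I : Ideal (MvPolynomial (Fin n) K)) (A : List (MvPolynomial (Fin n) K)) :
    Prop :=
  AscendingSet A ∧ (∀ a ∈ A, a ∈ I) ∧
    ∀ B : List (MvPolynomial (Fin n) K), AscendingSet B → (∀ b ∈ B, b ∈ I) → ¬ ascLT B A

/-- The saturated ideal of a triangular set, as a set of polynomials. -/
def satTS (L : List (MvPolynomial (Fin n) K)) : Set (MvPolynomial (Fin n) K) :=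
  {F | ∃ q : ℕ, 0 < q ∧ (L.map ini).prod ^ q * F ∈ Ideal.span {T | T ∈ L}}

/-- A regular set: a triangular set such that `res(ini(T_j), [T_1, …, T_{j-1}]) ≠ 0`
for `j = 2, …, r`. -/
def RegularSet (L : List (MvPolynomial (Fin n) K)) : Prop :=
  TriangularSet L ∧
    ∀ j : ℕ, 0 < j → j < L.length → resTS (ini (L.getD j 0)) (L.take j) ≠ 0

/-- A normal triangular set: `deg(ini(T_j), lv(T_i)) = 0` for all `i < j`. -/
def NormalSet (L : List (MvPolynomial (Fin n) K)) : Prop :=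
  TriangularSet L ∧ L.Pairwise fun A B => degLv (ini B) A = 0

/-- The purely lexicographical order on monomials determined by `x_1 < ⋯ < x_n`. -/
def plexLT (a b : Fin n →₀ ℕ) : Prop :=
  ∃ k : Fin n, a k < b k ∧ ∀ j : Fin n, k < j → a j = b j

/-- `m` is the leading monomial of `P` w.r.t. the plex order. -/
def IsLpp (P : MvPolynomial (Fin n) K) (m : Fin n →₀ ℕ) : Prop :=
  m ∈ P.support ∧ ∀ m' ∈ P.support, m' ≠ m → plexLT m' m

/-- `G` is the reduced (Buchberger–)Gröbner basis of the ideal `I` w.r.t. the plex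
term order determined by `x_1 < ⋯ < x_n`: its elements are nonzero monic members of `I`,
the leading monomial of every nonzero member of `I` is divisible by the leading monomial
of some element of `G`, every element of `G` is B-reduced w.r.t. the others, and `G`
generates `I`. -/
def IsReducedGB (I : Ideal (MvPolynomial (Fin n) K)) (G : Finset (MvPolynomial (Fin n) K)) :
    Prop :=
  (∀ g ∈ G, g ∈ I ∧ g ≠ 0 ∧ ∀ m, IsLpp g m → g.coeff m = 1) ∧
    (∀ F ∈ I, F ≠ 0 → ∃ g ∈ G, ∃ mg mF, IsLpp g mg ∧ IsLpp F mF ∧ mg ≤ mF) ∧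
    (∀ g ∈ G, ∀ g' ∈ G, g' ≠ g → ∀ m ∈ g.support, ∀ m', IsLpp g' m' → ¬ m' ≤ m) ∧
    Ideal.span (G : Set (MvPolynomial (Fin n) K)) = I

/-- `Cs` is the W-characteristic set of `I`: the minimal triangular set contained in the
reduced plex Gröbner basis `G` of `I`, i.e. for each class realized in `G`, `Cs` contains
the element of that class whose leading monomial is minimal w.r.t. the plex order, the
elements being ordered by increasing class (equivalently, by the plex order). -/
def IsWCharSet (I : Ideal (MvPolynomial (Fin n) K)) (Cs : List (MvPolynomial (Fin n) K)) :
    Prop :=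
  ∃ G : Finset (MvPolynomial (Fin n) K), IsReducedGB I G ∧
    (Cs.Chain' fun A B => cls A < cls B) ∧
    (∀ c ∈ Cs, c ∈ G) ∧
    (∀ g ∈ G, ∃ c ∈ Cs, cls c = cls g) ∧
    ∀ c ∈ Cs, ∀ g ∈ G, cls g = cls c → g ≠ c →
      ∃ mc mg, IsLpp c mc ∧ IsLpp g mg ∧ plexLT mc mg

/-- The set of common zeros of a set `S` of polynomials over `k`, taken in `Kc ^ n`
for an extension `Kc` of `k`. -/
def zeroSet {k : Type*} [Field k] (Kc : Type*) [CommRing Kc] [Algebra k Kc]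
    (S : Set (MvPolynomial (Fin n) k)) : Set (Fin n → Kc) :=
  {a | ∀ p ∈ S, MvPolynomial.aeval a p = 0}


/-! ### Coefficients with respect to one variable -/

/-- A polynomial is the sum of its homogeneous parts with respect to one variable. -/
theorem sum_coefv_mul_X_pow (i : Fin n) (F : MvPolynomial (Fin n) K) :
    ∑ d ∈ Finset.range (F.degreeOf i + 1), coefv i d F * X i ^ d = F := by
  have h : ∀ m ∈ F.support, m i ∈ Finset.range (F.degreeOf i + 1) := fun m hm =>
    Finset.mem_range.2 (Nat.lt_succ_of_le (monomial_le_degreeOf i hm))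
  conv_rhs => rw [F.as_sum, ← Finset.sum_fiberwise_of_maps_to h]
  refine Finset.sum_congr rfl fun d _ => ?_
  rw [coefv, Finset.sum_mul]
  refine Finset.sum_congr rfl fun m hm => ?_
  obtain ⟨-, rfl⟩ := Finset.mem_filter.1 hm
  rw [X_pow_eq_monomial, monomial_mul, mul_one, Finsupp.erase_add_single]

theorem coefv_eq_zero_of_lt {i : Fin n} {d : ℕ} {F : MvPolynomial (Fin n) K}
    (h : F.degreeOf i < d) : coefv i d F = 0 := by
  rw [coefv, Finset.filter_false_of_mem, Finset.sum_empty]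
  intro m hm hd
  have := monomial_le_degreeOf i hm
  omega

theorem degreeOf_coefv_le_of_le (i j : Fin n) (d b : ℕ) (F : MvPolynomial (Fin n) K)
    (h : ∀ m ∈ F.support, Finsupp.erase i m j ≤ b) : (coefv i d F).degreeOf j ≤ b := by
  refine (degreeOf_sum_le j _ _).trans (Finset.sup_le fun m hm => ?_)
  have hm := (Finset.mem_filter.1 hm).1
  rw [degreeOf_monomial_eq _ _ (mem_support_iff.1 hm)]
  exact h m hm

theorem degreeOf_coefv_self (i : Fin n) (d : ℕ) (F : MvPolynomial (Fin n) K) :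
    (coefv i d F).degreeOf i = 0 :=
  Nat.le_zero.1 (degreeOf_coefv_le_of_le i i d 0 F fun m _ => by simp)

theorem degreeOf_coefv_le (i j : Fin n) (d : ℕ) (F : MvPolynomial (Fin n) K) :
    (coefv i d F).degreeOf j ≤ F.degreeOf j := by
  refine degreeOf_coefv_le_of_le i j d _ F fun m hm => le_trans ?_ (monomial_le_degreeOf j hm)
  by_cases hij : j = i
  · simp [hij]
  · simp [Finsupp.erase_ne hij]

theorem degreeOf_lcv_self (i : Fin n) (F : MvPolynomial (Fin n) K) :
    (lcv i F).degreeOf i = 0 :=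
  degreeOf_coefv_self _ _ _

theorem degreeOf_lcv_le (i j : Fin n) (F : MvPolynomial (Fin n) K) :
    (lcv i F).degreeOf j ≤ F.degreeOf j :=
  degreeOf_coefv_le _ _ _ _

theorem lcv_ne_zero {i : Fin n} {F : MvPolynomial (Fin n) K} (h : 0 < F.degreeOf i) :
    lcv i F ≠ 0 := by
  intro h0
  have hF := sum_coefv_mul_X_pow i F
  rw [Finset.sum_range_succ, show coefv i (F.degreeOf i) F = 0 from h0, zero_mul, add_zero] at hF
  have : F.degreeOf i < F.degreeOf i := by
    conv_lhs => rw [← hF]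
    refine (degreeOf_sum_le i _ _).trans_lt ((Finset.sup_lt_iff h).2 fun d hd => ?_)
    refine (degreeOf_mul_le i _ _).trans_lt ?_
    rw [degreeOf_coefv_self, zero_add]
    refine (degreeOf_pow_le i _ _).trans_lt ?_
    rw [degreeOf_X_self, mul_one]
    exact Finset.mem_range.1 hd
  exact lt_irrefl _ this

theorem aeval_congr_of_degreeOf {A : Type*} [CommRing A] [Algebra K A] {ξ η : Fin n → A}
    {F : MvPolynomial (Fin n) K} (h : ∀ i, F.degreeOf i ≠ 0 → ξ i = η i) :
    aeval ξ F = aeval η F :=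
  eval₂Hom_congr' rfl (fun i hi _ => h i (mem_vars_iff_degreeOf_ne_zero.1 hi)) rfl

theorem aeval_eq_sum_coefv {A : Type*} [CommRing A] [Algebra K A] (ξ : Fin n → A) (i : Fin n)
    (F : MvPolynomial (Fin n) K) :
    aeval ξ F = ∑ d ∈ Finset.range (F.degreeOf i + 1), aeval ξ (coefv i d F) * ξ i ^ d := by
  conv_lhs => rw [← sum_coefv_mul_X_pow i F]
  simp

/-! ### Partial evaluation -/

/-- Evaluation at `ξ` of all variables except `x_i`. -/
noncomputable def evalExcept {A : Type*} [CommRing A] [Algebra K A] (i : Fin n) (ξ : Fin n → A) :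
    MvPolynomial (Fin n) K →ₐ[K] Polynomial A :=
  aeval (Function.update (fun l => Polynomial.C (ξ l)) i Polynomial.X)

section evalExcept

variable {A : Type*} [CommRing A] [Algebra K A]

theorem evalExcept_X (i : Fin n) (ξ : Fin n → A) :
    evalExcept (K := K) i ξ (X i) = Polynomial.X := by
  simp [evalExcept]

theorem evalExcept_of_degreeOf_eq_zero {i : Fin n} (ξ : Fin n → A)
    {F : MvPolynomial (Fin n) K} (h : F.degreeOf i = 0) :
    evalExcept i ξ F = Polynomial.C (aeval ξ F) := by
  have h1 : evalExcept i ξ F = aeval (fun l => Polynomial.C (ξ l)) F := by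
    refine aeval_congr_of_degreeOf fun j hj => ?_
    rw [Function.update_of_ne]
    rintro rfl
    exact hj h
  rw [h1]
  have h2 : (aeval fun l => Polynomial.C (ξ l)) =
      (Polynomial.CAlgHom (R := K) (A := A)).comp (aeval (R := K) ξ) := by
    ext l
    simp
  rw [h2]
  rfl

theorem coeff_evalExcept (i : Fin n) (ξ : Fin n → A) (F : MvPolynomial (Fin n) K) (d : ℕ) :
    (evalExcept i ξ F).coeff d = aeval ξ (coefv i d F) := by
  conv_lhs => rw [← sum_coefv_mul_X_pow i F]
  simp only [map_sum, map_mul, map_pow, evalExcept_X, Polynomial.finsetSum_coeff,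
    evalExcept_of_degreeOf_eq_zero ξ (degreeOf_coefv_self _ _ _), Polynomial.coeff_C_mul_X_pow]
  by_cases hd : d ≤ F.degreeOf i
  · simp [hd]
  · rw [coefv_eq_zero_of_lt (not_le.1 hd)]
    simp [hd]

theorem natDegree_evalExcept_le (i : Fin n) (ξ : Fin n → A) (F : MvPolynomial (Fin n) K) :
    (evalExcept i ξ F).natDegree ≤ F.degreeOf i := by
  refine Polynomial.natDegree_le_iff_coeff_eq_zero.2 fun d hd => ?_
  rw [coeff_evalExcept, coefv_eq_zero_of_lt hd, map_zero]

theorem natDegree_evalExcept_eq (i : Fin n) (ξ : Fin n → A) {F : MvPolynomial (Fin n) K}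
    (h : aeval ξ (lcv i F) ≠ 0) : (evalExcept i ξ F).natDegree = F.degreeOf i := by
  refine le_antisymm (natDegree_evalExcept_le i ξ F) (Polynomial.le_natDegree_of_ne_zero ?_)
  rwa [coeff_evalExcept]

theorem aeval_update_eq_eval (i : Fin n) (ξ : Fin n → A) (a : A) (F : MvPolynomial (Fin n) K) :
    aeval (Function.update ξ i a) F = (evalExcept i ξ F).eval a := by
  have h : aeval (Function.update ξ i a) =
      ((Polynomial.aeval a).restrictScalars K).comp (evalExcept (K := K) i ξ) := by
    ext l
    by_cases hl : l = i
    · subst hl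
      simp [evalExcept]
    · simp [evalExcept, hl]
  rw [h]
  simp

end evalExcept

theorem natDegree_evalExcept_X (i : Fin n) (F : MvPolynomial (Fin n) K) :
    (evalExcept i (X : Fin n → MvPolynomial (Fin n) K) F).natDegree = F.degreeOf i := by
  rcases Nat.eq_zero_or_pos (F.degreeOf i) with h | h
  · exact le_antisymm (natDegree_evalExcept_le _ _ _) (h ▸ Nat.zero_le _)
  · refine natDegree_evalExcept_eq i _ ?_
    rw [aeval_X_left_apply]
    exact lcv_ne_zero h

/-! ### Pseudo-division -/

theorem degreeOf_pseudo_step_lt {i : Fin n} {F R : MvPolynomial (Fin n) K}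
    (hF : 0 < F.degreeOf i) (h : F.degreeOf i ≤ R.degreeOf i) :
    (lcv i F * R - coefv i (R.degreeOf i) R * X i ^ (R.degreeOf i - F.degreeOf i) * F).degreeOf i
      < R.degreeOf i := by
  rw [← natDegree_evalExcept_X]
  set l := R.degreeOf i
  have hmul : ∀ (H : MvPolynomial (Fin n) K), H.degreeOf i = 0 →
      evalExcept i (X : Fin n → MvPolynomial (Fin n) K) H = Polynomial.C H := fun H hH => by
    rw [evalExcept_of_degreeOf_eq_zero _ hH, aeval_X_left_apply]
  rw [map_sub, map_mul, map_mul, map_mul, map_pow, evalExcept_X, hmul _ (degreeOf_lcv_self _ _),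
    hmul _ (degreeOf_coefv_self _ _ _)]
  have hl : 0 < l := hF.trans_le h
  refine Nat.lt_of_le_pred hl (Polynomial.natDegree_le_iff_coeff_eq_zero.2 fun N hN => ?_)
  rw [Polynomial.coeff_sub, Polynomial.coeff_C_mul, mul_assoc, Polynomial.coeff_C_mul,
    Polynomial.coeff_X_pow_mul', if_pos (by rw [Nat.pred_eq_sub_one] at hN; omega),
    coeff_evalExcept, coeff_evalExcept, aeval_X_left_apply, aeval_X_left_apply]
  rcases (Nat.le_of_pred_lt hN).eq_or_lt with rfl | hlt
  · rw [Nat.sub_sub_self h, lcv, mul_comm, sub_self]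
  · rw [coefv_eq_zero_of_lt hlt, coefv_eq_zero_of_lt (F := F) (by omega)]
    simp

theorem degreeOf_pdivAux_lt {i : Fin n} {F : MvPolynomial (Fin n) K} (hF : 0 < F.degreeOf i) :
    ∀ (q : ℕ) (QR : MvPolynomial (Fin n) K × MvPolynomial (Fin n) K),
      QR.2.degreeOf i < F.degreeOf i + q → (pdivAux i F q QR).2.degreeOf i < F.degreeOf i
  | 0, QR, h => h
  | q + 1, QR, h => by
    rw [pdivAux]
    split_ifs with hlt
    · refine (degreeOf_mul_le _ _ _).trans_lt ?_
      have := degreeOf_pow_le i (lcv i F) (q + 1)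
      rw [degreeOf_lcv_self, mul_zero] at this
      omega
    · refine degreeOf_pdivAux_lt hF q _ ?_
      have := degreeOf_pseudo_step_lt hF (not_lt.1 hlt)
      dsimp only
      omega

theorem degreeOf_prem_lt {i : Fin n} {F : MvPolynomial (Fin n) K} (hF : 0 < F.degreeOf i)
    (G : MvPolynomial (Fin n) K) : (prem G F i).degreeOf i < F.degreeOf i :=
  degreeOf_pdivAux_lt hF _ _ (by dsimp only; omega)

theorem degreeOf_pdivAux_le {i j : Fin n} {F : MvPolynomial (Fin n) K} (hij : j ≠ i)
    (hF : F.degreeOf j = 0) :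
    ∀ (q : ℕ) (QR : MvPolynomial (Fin n) K × MvPolynomial (Fin n) K),
      (pdivAux i F q QR).2.degreeOf j ≤ QR.2.degreeOf j
  | 0, QR => le_rfl
  | q + 1, QR => by
    have hl := degreeOf_lcv_le i j F
    rw [pdivAux]
    split_ifs with hlt
    · refine (degreeOf_mul_le _ _ _).trans ?_
      have := degreeOf_pow_le j (lcv i F) (q + 1)
      rw [show (lcv i F).degreeOf j = 0 by omega, mul_zero] at this
      omega
    · refine (degreeOf_pdivAux_le hij hF q _).trans ((degreeOf_sub_le _ _ _).trans ?_)
      refine max_le ((degreeOf_mul_le _ _ _).trans (by omega)) ?_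
      refine (degreeOf_mul_le _ _ _).trans ?_
      have h1 := degreeOf_mul_le j (coefv i (QR.2.degreeOf i) QR.2)
        (X i ^ (QR.2.degreeOf i - F.degreeOf i))
      have h2 := degreeOf_pow_le j (X i : MvPolynomial (Fin n) K) (QR.2.degreeOf i - F.degreeOf i)
      rw [degreeOf_X_of_ne hij, mul_zero] at h2
      have h3 := degreeOf_coefv_le i j (QR.2.degreeOf i) QR.2
      omega

theorem degreeOf_prem_le {i j : Fin n} {F : MvPolynomial (Fin n) K} (hij : j ≠ i)
    (hF : F.degreeOf j = 0) (G : MvPolynomial (Fin n) K) :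
    (prem G F i).degreeOf j ≤ G.degreeOf j :=
  degreeOf_pdivAux_le hij hF _ _

theorem map_pdivAux {S : Type*} [CommRing S] (f : MvPolynomial (Fin n) K →+* S) {i : Fin n}
    {F : MvPolynomial (Fin n) K} (hF : f F = 0) :
    ∀ (q : ℕ) (QR : MvPolynomial (Fin n) K × MvPolynomial (Fin n) K),
      f (pdivAux i F q QR).2 = f (lcv i F) ^ q * f QR.2
  | 0, QR => by simp [pdivAux]
  | q + 1, QR => by
    rw [pdivAux]
    split_ifs with hlt
    · simp
    · rw [map_pdivAux f hF q]
      simp only [map_sub, map_mul, hF]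
      ring

theorem map_prem {S : Type*} [CommRing S] (f : MvPolynomial (Fin n) K →+* S) {i : Fin n}
    {F : MvPolynomial (Fin n) K} (hF : f F = 0) (G : MvPolynomial (Fin n) K) :
    f (prem G F i) = f (lcv i F) ^ (G.degreeOf i + 1 - F.degreeOf i) * f G :=
  map_pdivAux f hF _ _

/-! ### Resultants -/

theorem degreeOf_resv (F G : MvPolynomial (Fin n) K) {i j : Fin n}
    (h : j = i ∨ F.degreeOf j = 0 ∧ G.degreeOf j = 0) : (resv F G i).degreeOf j = 0 := by
  have hc : ∀ r c, (sylvester i F G r c).degreeOf j = 0 := by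
    have hF : ∀ d, (coefv i d F).degreeOf j = 0 := fun d => by
      rcases h with rfl | h
      · exact degreeOf_coefv_self _ _ _
      · exact Nat.le_zero.1 (h.1 ▸ degreeOf_coefv_le i j d F)
    have hG : ∀ d, (coefv i d G).degreeOf j = 0 := fun d => by
      rcases h with rfl | h
      · exact degreeOf_coefv_self _ _ _
      · exact Nat.le_zero.1 (h.2 ▸ degreeOf_coefv_le i j d G)
    intro r c
    simp only [sylvester, Matrix.of_apply]
    split_ifs <;> simp [hF, hG]
  rw [resv, Matrix.det_apply', ← Nat.le_zero]
  refine (degreeOf_sum_le _ _ _).trans (Finset.sup_le fun σ _ => ?_)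
  refine (degreeOf_mul_le _ _ _).trans ?_
  have h1 := degreeOf_prod_le j Finset.univ fun r => sylvester i F G (σ r) r
  rw [Finset.sum_eq_zero fun r _ => hc _ _] at h1
  have h2 : ((Equiv.Perm.sign σ : ℤ) : MvPolynomial (Fin n) K).degreeOf j = 0 := by
    rw [← map_intCast (C : K →+* MvPolynomial (Fin n) K), degreeOf_C]
  omega

theorem aeval_resv_eq_zero {A : Type*} [CommRing A] [IsDomain A] [Algebra K A] (ξ : Fin n → A)
    {F G : MvPolynomial (Fin n) K} {i : Fin n} (hpos : 0 < G.degreeOf i)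
    (hF : aeval ξ F = 0) (hG : aeval ξ G = 0) : aeval ξ (resv F G i) = 0 := by
  have key : ∀ (H : MvPolynomial (Fin n) K) (s N : ℕ), aeval ξ H = 0 → s + H.degreeOf i < N →
      ∑ c : Fin N, aeval ξ (if s ≤ (c : ℕ) ∧ (c : ℕ) ≤ s + H.degreeOf i then
        coefv i (H.degreeOf i + s - c) H else 0) * ξ i ^ (N - 1 - c) = 0 := by
    intro H s N hH hN
    rw [Fin.sum_univ_eq_sum_range (fun c => aeval ξ (if s ≤ c ∧ c ≤ s + H.degreeOf i then
        coefv i (H.degreeOf i + s - c) H else 0) * ξ i ^ (N - 1 - c)) N]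
    rw [aeval_eq_sum_coefv ξ i] at hH
    rw [← Finset.sum_subset (s₁ := (Finset.range (H.degreeOf i + 1)).image (s + ·))]
    · rw [Finset.sum_image (by intro a _ b _ h; simpa using h), ← Finset.sum_range_reflect]
      rw [← mul_zero (ξ i ^ (N - 1 - s - H.degreeOf i)), ← hH, Finset.mul_sum]
      refine Finset.sum_congr rfl fun d hd => ?_
      have hd := Finset.mem_range.1 hd
      rw [if_pos (by omega), show H.degreeOf i + s - (s + (H.degreeOf i + 1 - 1 - d)) = d by omega,
        show N - 1 - (s + (H.degreeOf i + 1 - 1 - d)) = (N - 1 - s - H.degreeOf i) + d by omega,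
        pow_add]
      ring
    · intro c hc
      simp only [Finset.mem_image, Finset.mem_range] at hc ⊢
      omega
    · intro c _ hc
      rw [if_neg, map_zero, zero_mul]
      intro h
      refine hc (Finset.mem_image.2 ⟨c - s, Finset.mem_range.2 (by omega), by omega⟩)
  rw [resv, AlgHom.map_det, ← Matrix.exists_mulVec_eq_zero_iff]
  set N := G.degreeOf i + F.degreeOf i with hNdef
  refine ⟨fun c : Fin N => ξ i ^ (N - 1 - (c : ℕ)), fun h => ?_, ?_⟩
  · have := congrFun h ⟨N - 1, by omega⟩
    simp at this
  · ext r
    have hr := r.2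
    simp only [Matrix.mulVec, dotProduct, Pi.zero_apply, AlgHom.mapMatrix_apply, Matrix.map_apply,
      sylvester, Matrix.of_apply]
    split_ifs with hlt
    · exact key F r N hF (by omega)
    · convert key G (r - G.degreeOf i) N hG (by omega) using 7
      omega

/-! ### Leading variables -/

/-- `x_p` is the leading variable of `F`. -/
def IsLeadVar (F : MvPolynomial (Fin n) K) (p : Fin n) : Prop :=
  0 < F.degreeOf p ∧ ∀ q, p < q → F.degreeOf q = 0

theorem degreeOf_eq_zero_of_cls_le {F : MvPolynomial (Fin n) K} {p : Fin n} (h : cls F ≤ p) :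
    F.degreeOf p = 0 := by
  by_contra hp
  have : (p : ℕ) + 1 ≤ cls F :=
    Finset.le_sup (f := fun i : Fin n => (i : ℕ) + 1) (mem_vars_iff_degreeOf_ne_zero.2 hp)
  omega

theorem lt_cls_of_degreeOf_pos {F : MvPolynomial (Fin n) K} {p : Fin n} (h : 0 < F.degreeOf p) :
    (p : ℕ) < cls F := by
  by_contra hp
  have := degreeOf_eq_zero_of_cls_le (not_lt.1 hp)
  omega

theorem exists_isLeadVar {F : MvPolynomial (Fin n) K} (h : 0 < cls F) : ∃ p, IsLeadVar F p := by
  have hne : F.vars.Nonempty := by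
    by_contra hne
    rw [Finset.not_nonempty_iff_eq_empty] at hne
    simp [cls, hne] at h
  refine ⟨F.vars.max' hne, ?_, fun q hq => ?_⟩
  · exact Nat.pos_of_ne_zero (mem_vars_iff_degreeOf_ne_zero.1 (F.vars.max'_mem hne))
  · by_contra hq'
    exact absurd (F.vars.le_max' q (mem_vars_iff_degreeOf_ne_zero.2 hq')) (not_le.2 hq)

namespace IsLeadVar

variable {F G : MvPolynomial (Fin n) K} {p : Fin n}

theorem vars_nonempty (h : IsLeadVar F p) : F.vars.Nonempty :=
  ⟨p, mem_vars_iff_degreeOf_ne_zero.2 h.1.ne'⟩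

theorem max'_vars (h : IsLeadVar F p) : F.vars.max' h.vars_nonempty = p := by
  refine le_antisymm (Finset.max'_le _ _ _ fun q hq => ?_)
    (Finset.le_max' _ _ (mem_vars_iff_degreeOf_ne_zero.2 h.1.ne'))
  by_contra hlt
  exact mem_vars_iff_degreeOf_ne_zero.1 hq (h.2 q (not_le.1 hlt))

theorem cls_eq (h : IsLeadVar F p) : cls F = p + 1 := by
  refine le_antisymm (Finset.sup_le fun q hq => ?_) (lt_cls_of_degreeOf_pos h.1)
  by_contra hlt
  exact mem_vars_iff_degreeOf_ne_zero.1 hq (h.2 q (Fin.lt_def.2 (by omega)))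

theorem of_cls_eq (h : IsLeadVar F p) (hc : cls G = cls F) : IsLeadVar G p := by
  obtain ⟨q, hq⟩ := exists_isLeadVar (F := G) (by rw [hc, h.cls_eq]; omega)
  have : q = p := Fin.ext (by have := hq.cls_eq; have := h.cls_eq; omega)
  exact this ▸ hq

theorem degLv_eq (h : IsLeadVar F p) (G : MvPolynomial (Fin n) K) :
    degLv G F = G.degreeOf p := by
  rw [degLv, dif_pos h.vars_nonempty, h.max'_vars]

theorem ini_eq (h : IsLeadVar F p) : ini F = lcv p F := by
  rw [ini, dif_pos h.vars_nonempty, h.max'_vars]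

theorem premLv_eq (h : IsLeadVar F p) (G : MvPolynomial (Fin n) K) :
    premLv G F = prem G F p := by
  rw [premLv, dif_pos h.vars_nonempty, h.max'_vars]

theorem resLv_eq (h : IsLeadVar F p) (G : MvPolynomial (Fin n) K) :
    resLv G F = resv G F p := by
  rw [resLv, dif_pos h.vars_nonempty, h.max'_vars]

theorem degreeOf_eq_zero (h : IsLeadVar F p) (hlt : cls G < cls F) : G.degreeOf p = 0 :=
  degreeOf_eq_zero_of_cls_le (by rw [h.cls_eq] at hlt; omega)

theorem rReduced_iff (h : IsLeadVar F p) : RReduced G F ↔ G.degreeOf p < F.degreeOf p := by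
  rw [RReduced, h.degLv_eq, h.degLv_eq]

end IsLeadVar

theorem degreeOf_ini_le (F : MvPolynomial (Fin n) K) (j : Fin n) :
    (ini F).degreeOf j ≤ F.degreeOf j := by
  rw [ini]
  split_ifs
  · exact degreeOf_lcv_le _ _ _
  · exact le_rfl

/-! ### Iterated resultants and pseudo-remainders -/

theorem degreeOf_resTS_of_degreeOf_eq_zero {F : MvPolynomial (Fin n) K} {j : Fin n}
    (hF : F.degreeOf j = 0) :
    ∀ {L : List (MvPolynomial (Fin n) K)}, (∀ T ∈ L, T.degreeOf j = 0) →
      (resTS F L).degreeOf j = 0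
  | [], _ => hF
  | T :: L, h => by
    have ih := degreeOf_resTS_of_degreeOf_eq_zero hF fun S hS => h S (List.mem_cons_of_mem _ hS)
    change (resLv (resTS F L) T).degreeOf j = 0
    rw [resLv]
    split_ifs
    · exact degreeOf_resv _ _ (Or.inr ⟨ih, h T List.mem_cons_self⟩)
    · exact ih

theorem degreeOf_resTS_of_isLeadVar (F : MvPolynomial (Fin n) K) {S : MvPolynomial (Fin n) K}
    {p : Fin n} (hp : IsLeadVar S p) :
    ∀ {L : List (MvPolynomial (Fin n) K)}, (∀ T ∈ L, 0 < cls T) →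
      L.Pairwise (fun A B => cls A < cls B) → S ∈ L → (resTS F L).degreeOf p = 0
  | T :: L, hpos, hL, hS => by
    change (resLv (resTS F L) T).degreeOf p = 0
    obtain ⟨q, hq⟩ := exists_isLeadVar (hpos T List.mem_cons_self)
    rw [hq.resLv_eq]
    rw [List.pairwise_cons] at hL
    rcases List.mem_cons.1 hS with rfl | hS
    · refine degreeOf_resv _ _ (Or.inl (Fin.ext ?_))
      have := hp.cls_eq
      have := hq.cls_eq
      omega
    · exact degreeOf_resv _ _ (Or.inr ⟨degreeOf_resTS_of_isLeadVar F hp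
        (fun U hU => hpos U (List.mem_cons_of_mem _ hU)) hL.2 hS,
        hp.degreeOf_eq_zero (hL.1 S hS)⟩)

theorem aeval_resTS_eq_zero {A : Type*} [CommRing A] [IsDomain A] [Algebra K A] (ξ : Fin n → A)
    {F : MvPolynomial (Fin n) K} (hF : aeval ξ F = 0) :
    ∀ {L : List (MvPolynomial (Fin n) K)}, (∀ T ∈ L, 0 < cls T ∧ aeval ξ T = 0) →
      aeval ξ (resTS F L) = 0
  | [], _ => hF
  | T :: L, h => by
    have ih := aeval_resTS_eq_zero ξ hF fun S hS => h S (List.mem_cons_of_mem _ hS)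
    obtain ⟨hT, hT0⟩ := h T List.mem_cons_self
    obtain ⟨q, hq⟩ := exists_isLeadVar hT
    change aeval ξ (resLv (resTS F L) T) = 0
    rw [hq.resLv_eq]
    exact aeval_resv_eq_zero ξ hq.1 ih hT0

theorem map_premTS_eq_zero {S : Type*} [CommRing S] (f : MvPolynomial (Fin n) K →+* S)
    {G : MvPolynomial (Fin n) K} (hG : f G = 0) :
    ∀ {L : List (MvPolynomial (Fin n) K)}, (∀ T ∈ L, f T = 0) → f (premTS G L) = 0
  | [], _ => hG
  | T :: L, h => by
    have ih := map_premTS_eq_zero f hG fun S hS => h S (List.mem_cons_of_mem _ hS)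
    change f (premLv (premTS G L) T) = 0
    rw [premLv]
    split_ifs
    · rw [map_prem f (h T List.mem_cons_self), ih, mul_zero]
    · exact map_zero f

theorem premTS_mem {I : Ideal (MvPolynomial (Fin n) K)} {G : MvPolynomial (Fin n) K} (hG : G ∈ I)
    {L : List (MvPolynomial (Fin n) K)} (hL : ∀ T ∈ L, T ∈ I) : premTS G L ∈ I :=
  Ideal.Quotient.eq_zero_iff_mem.1 (map_premTS_eq_zero (Ideal.Quotient.mk I)
    (Ideal.Quotient.eq_zero_iff_mem.2 hG) fun T hT => Ideal.Quotient.eq_zero_iff_mem.2 (hL T hT))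

theorem exists_map_premTS_eq_mul {S : Type*} [CommRing S] [IsDomain S]
    (f : MvPolynomial (Fin n) K →+* S) (G : MvPolynomial (Fin n) K) :
    ∀ {L : List (MvPolynomial (Fin n) K)}, (∀ T ∈ L, 0 < cls T ∧ f T = 0 ∧ f (ini T) ≠ 0) →
      ∃ e, e ≠ 0 ∧ f (premTS G L) = e * f G
  | [], _ => ⟨1, one_ne_zero, (one_mul _).symm⟩
  | T :: L, h => by
    obtain ⟨e, he, heq⟩ := exists_map_premTS_eq_mul f G fun S hS => h S (List.mem_cons_of_mem _ hS)
    obtain ⟨hT, hT0, hini⟩ := h T List.mem_cons_self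
    obtain ⟨q, hq⟩ := exists_isLeadVar hT
    rw [hq.ini_eq] at hini
    change ∃ e, e ≠ 0 ∧ f (premLv (premTS G L) T) = e * f G
    rw [hq.premLv_eq, map_prem f hT0, heq, ← mul_assoc]
    exact ⟨_, mul_ne_zero (pow_ne_zero _ hini) he, rfl⟩

theorem degreeOf_premTS_le (G : MvPolynomial (Fin n) K) {j : Fin n} :
    ∀ {L : List (MvPolynomial (Fin n) K)}, (∀ T ∈ L, T.degreeOf j = 0) →
      (premTS G L).degreeOf j ≤ G.degreeOf j
  | [], _ => le_rfl
  | T :: L, h => by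
    have ih := degreeOf_premTS_le G fun S hS => h S (List.mem_cons_of_mem _ hS)
    have hT := h T List.mem_cons_self
    change (premLv (premTS G L) T).degreeOf j ≤ _
    rw [premLv]
    split_ifs with hne
    · refine (degreeOf_prem_le ?_ hT _).trans ih
      rintro rfl
      exact mem_vars_iff_degreeOf_ne_zero.1 (T.vars.max'_mem hne) hT
    · simp

theorem degreeOf_premTS_lt (G : MvPolynomial (Fin n) K) {S : MvPolynomial (Fin n) K}
    {p : Fin n} (hp : IsLeadVar S p) :
    ∀ {L : List (MvPolynomial (Fin n) K)}, (∀ T ∈ L, 0 < cls T) →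
      L.Pairwise (fun A B => cls A < cls B) → S ∈ L →
      (premTS G L).degreeOf p < S.degreeOf p
  | T :: L, hpos, hL, hS => by
    change (premLv (premTS G L) T).degreeOf p < _
    rw [List.pairwise_cons] at hL
    rcases List.mem_cons.1 hS with rfl | hS
    · rw [hp.premLv_eq]
      exact degreeOf_prem_lt hp.1 _
    · obtain ⟨q, hq⟩ := exists_isLeadVar (hpos T List.mem_cons_self)
      have hlt := hL.1 S hS
      rw [hq.premLv_eq]
      refine (degreeOf_prem_le ?_ (hp.degreeOf_eq_zero hlt) _).trans_lt
        (degreeOf_premTS_lt G hp (fun U hU => hpos U (List.mem_cons_of_mem _ hU)) hL.2 hS)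
      rintro rfl
      rw [hp.cls_eq, hq.cls_eq] at hlt
      exact lt_irrefl _ hlt

/-! ### Generic zeros of regular sets -/

theorem TriangularSet.pairwise {D : List (MvPolynomial (Fin n) K)} (h : TriangularSet D) :
    D.Pairwise fun A B => cls A < cls B := by
  have : Trans (fun A B : MvPolynomial (Fin n) K => cls A < cls B)
      (fun A B : MvPolynomial (Fin n) K => cls A < cls B)
      (fun A B : MvPolynomial (Fin n) K => cls A < cls B) := ⟨fun h1 h2 => lt_trans h1 h2⟩
  exact List.isChain_iff_pairwise.1 h.2.2

/-- `ξ` is a zero of every element of `L` at which no nonzero polynomial free of the leading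
variables of `L` vanishes. -/
def IsGenericZero {A : Type*} [CommRing A] [Algebra K A] (ξ : Fin n → A)
    (L : List (MvPolynomial (Fin n) K)) : Prop :=
  (∀ T ∈ L, aeval ξ T = 0) ∧
    ∀ F : MvPolynomial (Fin n) K, F ≠ 0 →
      (∀ T ∈ L, ∀ p, IsLeadVar T p → F.degreeOf p = 0) → aeval ξ F ≠ 0

theorem IsGenericZero.aeval_ini_ne_zero {A : Type*} [CommRing A] [IsDomain A] [Algebra K A]
    {ξ : Fin n → A} {D : List (MvPolynomial (Fin n) K)} (hD : RegularSet D) {k : ℕ}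
    (hξ : IsGenericZero ξ (D.take k)) {l : ℕ} (hl : l < D.length) (hlk : l ≤ k) :
    aeval ξ (ini D[l]) ≠ 0 := by
  have hpw := hD.1.pairwise
  have hlt := List.pairwise_iff_getElem.1 hpw
  have htake : ∀ T ∈ D.take l, 0 < cls T := fun T hT => hD.1.2.1 T (List.mem_of_mem_take hT)
  have hne : resTS (ini D[l]) (D.take l) ≠ 0 := by
    rcases Nat.eq_zero_or_pos l with rfl | h0
    · obtain ⟨p, hp⟩ := exists_isLeadVar (hD.1.2.1 _ (List.getElem_mem hl))
      rw [List.take_zero, hp.ini_eq]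
      exact lcv_ne_zero hp.1
    · simpa [List.getD_eq_getElem, hl] using hD.2 l h0 hl
  intro h0
  refine hξ.2 _ hne (fun T hT p hp => ?_) (aeval_resTS_eq_zero ξ h0 fun T hT => ⟨htake T hT, ?_⟩)
  · obtain ⟨l', hl', rfl⟩ := List.mem_take_iff_getElem.1 hT
    by_cases hll : l' < l
    · exact degreeOf_resTS_of_isLeadVar _ hp htake (hpw.sublist (List.take_sublist _ _))
        (List.mem_take_iff_getElem.2 ⟨l', by omega, rfl⟩)
    · refine degreeOf_resTS_of_degreeOf_eq_zero ?_ fun T hT => ?_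
      · rcases (not_lt.1 hll).eq_or_lt with rfl | h
        · rw [hp.ini_eq]
          exact degreeOf_lcv_self _ _
        · exact Nat.le_zero.1 ((degreeOf_ini_le _ _).trans
            (hp.degreeOf_eq_zero (hlt _ _ hl (by omega) h)).le)
      · obtain ⟨m, hm, rfl⟩ := List.mem_take_iff_getElem.1 hT
        exact hp.degreeOf_eq_zero (hlt _ _ (by omega) (by omega) (by omega))
  · exact hξ.1 T (List.take_subset_take_left _ hlk hT)

theorem RegularSet.exists_isGenericZero {L : Type*} [Field L] [IsAlgClosed L] [Algebra K L]
    {ξ₀ : Fin n → L} (hξ₀ : ∀ F : MvPolynomial (Fin n) K, F ≠ 0 → aeval ξ₀ F ≠ 0)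
    {D : List (MvPolynomial (Fin n) K)} (hD : RegularSet D) :
    ∀ k ≤ D.length, ∃ ξ : Fin n → L, IsGenericZero ξ (D.take k)
  | 0, _ => ⟨ξ₀, by simp, fun F hF _ => hξ₀ F hF⟩
  | k + 1, hk => by
    obtain ⟨ξ, hξ⟩ := hD.exists_isGenericZero hξ₀ k (by omega)
    obtain ⟨p, hp⟩ := exists_isLeadVar (hD.1.2.1 _ (List.getElem_mem (n := k) (by omega)))
    have hini := hξ.aeval_ini_ne_zero hD (l := k) (by omega) le_rfl
    rw [hp.ini_eq] at hini
    have hdeg := natDegree_evalExcept_eq p ξ hini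
    obtain ⟨a, ha⟩ := IsAlgClosed.exists_root (evalExcept p ξ D[k]) fun h => by
      have h1 := hp.1
      rw [← hdeg, Polynomial.natDegree_eq_of_degree_eq_some h] at h1
      exact lt_irrefl _ h1
    have hupd : ∀ F : MvPolynomial (Fin n) K, F.degreeOf p = 0 →
        aeval (Function.update ξ p a) F = aeval ξ F := fun F hF =>
      aeval_congr_of_degreeOf fun j hj => Function.update_of_ne (by rintro rfl; exact hj hF) _ _
    have htake : D.take (k + 1) = D.take k ++ [D[k]] := by simp
    refine ⟨Function.update ξ p a, ?_, ?_⟩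
    · intro T hT
      rw [htake, List.mem_append, List.mem_singleton] at hT
      rcases hT with hT | rfl
      · rw [hupd, hξ.1 T hT]
        obtain ⟨l, hl, rfl⟩ := List.mem_take_iff_getElem.1 hT
        exact hp.degreeOf_eq_zero (List.pairwise_iff_getElem.1 hD.1.pairwise _ _ _ _ (by omega))
      · rw [aeval_update_eq_eval]
        exact ha
    · intro F hF hfree
      rw [htake] at hfree
      rw [hupd F (hfree _ (List.mem_append_right _ List.mem_cons_self) p hp)]
      exact hξ.2 F hF fun T hT => hfree T (List.mem_append_left _ hT)

theorem RegularSet.degreeOf_premTS {D : List (MvPolynomial (Fin n) K)} (hD : RegularSet D) {k : ℕ}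
    (hk : k < D.length) {p : Fin n} (hp : IsLeadVar D[k] p) :
    (premTS D[k] (D.take k)).degreeOf p = D[k].degreeOf p := by
  have hdeg : ∀ T ∈ D.take k, T.degreeOf p = 0 := by
    intro T hT
    obtain ⟨l, hl, rfl⟩ := List.mem_take_iff_getElem.1 hT
    exact hp.degreeOf_eq_zero (List.pairwise_iff_getElem.1 hD.1.pairwise _ _ _ _ (by omega))
  refine le_antisymm (degreeOf_premTS_le _ hdeg) ?_
  let L := AlgebraicClosure (FractionRing (MvPolynomial (Fin n) K))
  let ξ₀ : Fin n → L := fun l => algebraMap (MvPolynomial (Fin n) K) L (X l)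
  have hξ₀ : ∀ F : MvPolynomial (Fin n) K, F ≠ 0 → aeval ξ₀ F ≠ 0 := by
    intro F hF
    have hval : aeval ξ₀ F = algebraMap (MvPolynomial (Fin n) K) L F := by
      rw [← aeval_X_left_apply F]
      exact (aeval_algebraMap_apply L X _).trans (by rw [aeval_X_left_apply])
    rw [hval]
    have hinj : Function.Injective (algebraMap (MvPolynomial (Fin n) K) L) := by
      rw [IsScalarTower.algebraMap_eq _ (FractionRing (MvPolynomial (Fin n) K)) L]
      exact (algebraMap (FractionRing (MvPolynomial (Fin n) K)) L).injective.comp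
        (IsFractionRing.injective _ _)
    exact (map_ne_zero_iff _ hinj).2 hF
  obtain ⟨ξ, hξ⟩ := hD.exists_isGenericZero hξ₀ k hk.le
  obtain ⟨e, he, heq⟩ := exists_map_premTS_eq_mul (evalExcept p ξ).toRingHom D[k]
    (L := D.take k) fun T hT => by
      refine ⟨hD.1.2.1 T (List.mem_of_mem_take hT), ?_, ?_⟩
      · change evalExcept p ξ T = 0
        rw [evalExcept_of_degreeOf_eq_zero ξ (hdeg T hT), hξ.1 T hT, map_zero]
      · change evalExcept p ξ (ini T) ≠ 0
        rw [evalExcept_of_degreeOf_eq_zero ξ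
          (Nat.le_zero.1 ((degreeOf_ini_le T p).trans (hdeg T hT).le)), Polynomial.C_ne_zero]
        obtain ⟨l, hl, rfl⟩ := List.mem_take_iff_getElem.1 hT
        exact hξ.aeval_ini_ne_zero hD (by omega) (by omega)
  have hini := hξ.aeval_ini_ne_zero hD hk le_rfl
  rw [hp.ini_eq] at hini
  have hnat := natDegree_evalExcept_eq p ξ hini
  have hne : evalExcept p ξ D[k] ≠ 0 := by
    intro h
    rw [h, Polynomial.natDegree_zero] at hnat
    exact hp.1.ne hnat
  calc D[k].degreeOf p = (evalExcept p ξ D[k]).natDegree := hnat.symm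
    _ ≤ (e * evalExcept p ξ D[k]).natDegree := by
      rw [Polynomial.natDegree_mul he hne]
      omega
    _ = (evalExcept p ξ (premTS D[k] (D.take k))).natDegree :=
      congrArg Polynomial.natDegree heq.symm
    _ ≤ _ := natDegree_evalExcept_le _ _ _

theorem RegularSet.isLeadVar_premTS {D : List (MvPolynomial (Fin n) K)} (hD : RegularSet D) {k : ℕ}
    (hk : k < D.length) {p : Fin n} (hp : IsLeadVar D[k] p) :
    IsLeadVar (premTS D[k] (D.take k)) p := by
  refine ⟨(hD.degreeOf_premTS hk hp).symm ▸ hp.1, fun q hq => ?_⟩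
  refine Nat.le_zero.1 ((degreeOf_premTS_le _ fun T hT => ?_).trans (hp.2 q hq).le)
  obtain ⟨l, hl, rfl⟩ := List.mem_take_iff_getElem.1 hT
  have hlt := List.pairwise_iff_getElem.1 hD.1.pairwise l k (by omega) hk (by omega)
  rw [hp.cls_eq] at hlt
  exact degreeOf_eq_zero_of_cls_le (by rw [Fin.lt_def] at hq; omega)

/-- The iterated pseudo-remainders of a regular set form an ascending set. -/
theorem RegularSet.ascendingSet_premTS {D : List (MvPolynomial (Fin n) K)} (hD : RegularSet D) :
    AscendingSet (D.mapIdx fun j c => premTS c (D.take j)) := by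
  have hlead : ∀ k (hk : k < D.length), ∃ p, IsLeadVar D[k] p := fun k hk =>
    exists_isLeadVar (hD.1.2.1 _ (List.getElem_mem hk))
  have hcls : ∀ k (hk : k < D.length), cls (premTS D[k] (D.take k)) = cls D[k] := by
    intro k hk
    obtain ⟨p, hp⟩ := hlead k hk
    rw [hp.cls_eq, (hD.isLeadVar_premTS hk hp).cls_eq]
  refine Or.inr ⟨⟨?_, ?_, ?_⟩, ?_⟩
  · simpa using hD.1.1
  · intro T hT
    obtain ⟨k, hk, rfl⟩ := List.getElem_of_mem hT
    rw [List.length_mapIdx] at hk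
    rw [List.getElem_mapIdx, hcls k hk]
    exact hD.1.2.1 _ (List.getElem_mem hk)
  · refine List.isChain_iff_getElem.2 fun k hk => ?_
    rw [List.length_mapIdx] at hk
    rw [List.getElem_mapIdx, List.getElem_mapIdx, hcls, hcls]
    exact List.isChain_iff_getElem.1 hD.1.2.2 k hk
  · refine List.pairwise_iff_getElem.2 fun k l hk hl hkl => ?_
    rw [List.length_mapIdx] at hk hl
    obtain ⟨p, hp⟩ := hlead k hk
    rw [List.getElem_mapIdx, List.getElem_mapIdx, (hD.isLeadVar_premTS hk hp).rReduced_iff,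
      hD.degreeOf_premTS hk hp]
    exact degreeOf_premTS_lt _ hp (fun T hT => hD.1.2.1 T (List.mem_of_mem_take hT))
      (hD.1.pairwise.sublist (List.take_sublist _ _))
      (List.mem_take_iff_getElem.2 ⟨k, by omega, rfl⟩)

/-! ### Minimality -/

theorem rkEQ.cls_eq {F G : MvPolynomial (Fin n) K} (h : rkEQ F G) : cls F = cls G := by
  have h1 : ¬ cls F < cls G := fun hlt => h.1 (Or.inl hlt)
  have h2 : ¬ cls G < cls F := fun hlt => h.2 (Or.inl hlt)
  omega

theorem rkEQ.degreeOf_eq {F G : MvPolynomial (Fin n) K} (h : rkEQ F G) {p : Fin n}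
    (hp : IsLeadVar F p) : G.degreeOf p = F.degreeOf p := by
  have hc := h.cls_eq
  have hG := hp.of_cls_eq hc.symm
  have hpos : 0 < cls F := by rw [hp.cls_eq]; omega
  have h1 : ¬ degLv F F < degLv G G := fun hlt => h.1 (Or.inr ⟨hc, hpos, hlt⟩)
  have h2 : ¬ degLv G G < degLv F F := fun hlt => h.2 (Or.inr ⟨hc.symm, hc ▸ hpos, hlt⟩)
  rw [hp.degLv_eq, hG.degLv_eq] at h1 h2
  omega

/-- An ascending set of a proper ideal is a characteristic set as soon as the ideal contains no
nonzero polynomial reduced with respect to it. -/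
theorem rittCharSet_of_no_reduced {I : Ideal (MvPolynomial (Fin n) K)} (hI : I ≠ ⊤)
    {A : List (MvPolynomial (Fin n) K)} (hA : AscendingSet A) (hmem : ∀ a ∈ A, a ∈ I)
    (hred : ∀ b ∈ I, b ≠ 0 → ∃ l, ∃ _ : l < A.length, ∃ p,
      IsLeadVar A[l] p ∧ A[l].degreeOf p ≤ b.degreeOf p) :
    RittCharSet I A := by
  have htri : ∀ {B : List (MvPolynomial (Fin n) K)}, AscendingSet B → (∀ b ∈ B, b ∈ I) →
      TriangularSet B ∧ B.Pairwise fun F G => RReduced G F := by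
    rintro B (⟨a, ha, rfl⟩ | h) hB
    · exact absurd (I.eq_top_of_isUnit_mem (hB _ (by simp)) ((isUnit_iff_ne_zero.2 ha).map C)) hI
    · exact h
  refine ⟨hA, hmem, fun B hB hBmem hlt => ?_⟩
  have hAt := (htri hA hmem).1
  obtain ⟨hBt, hBred⟩ := htri hB hBmem
  obtain ⟨j, hjB, hjA, heq, hrk⟩ : ∃ j, j < B.length ∧ j ≤ A.length ∧
      (∀ i, i < j → rkEQ (A.getD i 0) (B.getD i 0)) ∧
      (j < A.length → rkLT (B.getD j 0) (A.getD j 0)) := by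
    rcases hlt with ⟨j, hj, heq, hrk⟩ | ⟨hlen, heq⟩
    · exact ⟨j, by omega, by omega, heq, fun _ => hrk⟩
    · exact ⟨A.length, hlen, le_rfl, heq, fun h => absurd h (lt_irrefl _)⟩
  have hbB : B[j] ∈ B := List.getElem_mem hjB
  have hb0 : B[j] ≠ 0 := by
    intro h
    have := hBt.2.1 _ hbB
    simp [h, cls] at this
  obtain ⟨l, hl, p, hp, hle⟩ := hred _ (hBmem _ hbB) hb0
  have hpos : 0 < B[j].degreeOf p := hp.1.trans_le hle
  have hcls := lt_cls_of_degreeOf_pos hpos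
  rcases lt_or_ge l j with hlj | hjl
  · have hE := heq l hlj
    have hlB : l < B.length := by omega
    rw [List.getD_eq_getElem _ _ hl, List.getD_eq_getElem _ _ hlB] at hE
    have hr := List.pairwise_iff_getElem.1 hBred l j hlB hjB hlj
    rw [(hp.of_cls_eq hE.cls_eq.symm).rReduced_iff, hE.degreeOf_eq hp] at hr
    omega
  · have hjA' : j < A.length := by omega
    have hrk := hrk hjA'
    rw [List.getD_eq_getElem _ _ hjA', List.getD_eq_getElem _ _ hjB] at hrk
    have hcA := hp.cls_eq
    rcases hjl.eq_or_lt with rfl | hjl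
    · rcases hrk with h | ⟨h, -, hd⟩
      · omega
      · rw [hp.degLv_eq, (hp.of_cls_eq h).degLv_eq] at hd
        omega
    · have hlt := List.pairwise_iff_getElem.1 hAt.pairwise j l hjA' hl hjl
      rcases hrk with h | ⟨h, -, -⟩ <;> omega

/-! ### W-characteristic sets -/

theorem IsLpp.apply_eq_degreeOf {F : MvPolynomial (Fin n) K} {m : Fin n →₀ ℕ} (h : IsLpp F m)
    {p : Fin n} (hp : IsLeadVar F p) : m p = F.degreeOf p := by
  refine le_antisymm (monomial_le_degreeOf p h.1) (degreeOf_le_iff.2 fun m' hm' => ?_)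
  by_cases hne : m' = m
  · rw [hne]
  · obtain ⟨k, hk, hkeq⟩ := h.2 m' hm' hne
    rcases lt_trichotomy k p with hkp | rfl | hkp
    · exact (hkeq p hkp).le
    · exact hk.le
    · have h1 := monomial_le_degreeOf k h.1
      rw [hp.2 k hkp] at h1
      omega

/-- Every nonzero element of the ideal has degree at least `deg(c, lv(c))` in the leading variable
of some element `c` of the W-characteristic set. -/
theorem IsWCharSet.exists_degreeOf_le {I : Ideal (MvPolynomial (Fin n) K)} (hI : I ≠ ⊤)
    {Cs : List (MvPolynomial (Fin n) K)} (hW : IsWCharSet I Cs) {b : MvPolynomial (Fin n) K}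
    (hb : b ∈ I) (hb0 : b ≠ 0) :
    ∃ c ∈ Cs, ∃ p, IsLeadVar c p ∧ c.degreeOf p ≤ b.degreeOf p := by
  obtain ⟨G, hG, -, -, hclass, hmin⟩ := hW
  obtain ⟨g, hg, mg, mb, hmg, hmb, hle⟩ := hG.2.1 b hb hb0
  obtain ⟨hgI, hg0, -⟩ := hG.1 g hg
  have hgpos : 0 < cls g := by
    by_contra hcls
    have hgC : g = C (g.coeff 0) := by
      refine totalDegree_eq_zero_iff_eq_C.1 ((totalDegree_eq_zero_iff _ g).2 fun m hm x => ?_)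
      have h1 := monomial_le_degreeOf x hm
      rw [degreeOf_eq_zero_of_cls_le (by omega)] at h1
      omega
    have hc : g.coeff 0 ≠ 0 := fun h => hg0 (by rw [hgC, h, C_0])
    rw [hgC] at hgI
    exact hI (I.eq_top_of_isUnit_mem hgI ((isUnit_iff_ne_zero.2 hc).map C))
  obtain ⟨p, hp⟩ := exists_isLeadVar hgpos
  obtain ⟨c, hc, hcg⟩ := hclass g hg
  have hcp := hp.of_cls_eq hcg
  refine ⟨c, hc, p, hcp, ?_⟩
  have hgb : g.degreeOf p ≤ b.degreeOf p := by
    rw [← hmg.apply_eq_degreeOf hp]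
    exact (hle p).trans (monomial_le_degreeOf p hmb.1)
  refine le_trans ?_ hgb
  by_cases hgc : g = c
  · rw [hgc]
  · obtain ⟨mc, mg', hmc, hmg', k, hk, hkeq⟩ := hmin c hc g hg hcg.symm hgc
    rw [← hmc.apply_eq_degreeOf hcp, ← hmg'.apply_eq_degreeOf hp]
    rcases lt_trichotomy k p with hkp | rfl | hkp
    · exact (hkeq p hkp).le
    · exact hk.le
    · have h1 := monomial_le_degreeOf k hmg'.1
      rw [hp.2 k hkp] at h1
      omega

theorem isLeadVar_of_rename {i : ℕ} (hi : i ≤ n) {F : MvPolynomial (Fin i) K} {p : Fin i}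
    (h : IsLeadVar (rename (Fin.castLE hi) F) (Fin.castLE hi p)) : IsLeadVar F p := by
  have hinj := Fin.castLE_injective hi
  refine ⟨?_, fun q hq => ?_⟩
  · simpa only [degreeOf_rename_of_injective hinj] using h.1
  · rw [← degreeOf_rename_of_injective hinj]
    exact h.2 _ (Fin.lt_def.2 hq)

theorem exists_castLE_of_degreeOf_rename_pos {i : ℕ} (hi : i ≤ n) {F : MvPolynomial (Fin i) K}
    {p : Fin n} (h : 0 < (rename (Fin.castLE hi) F).degreeOf p) :
    ∃ q : Fin i, Fin.castLE hi q = p := by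
  classical
  have := vars_rename (Fin.castLE hi) F (mem_vars_iff_degreeOf_ne_zero.2 h.ne')
  obtain ⟨q, -, hq⟩ := Finset.mem_image.1 this
  exact ⟨q, hq⟩

/-- Corollary maincor0. Let `C` be the W-characteristic set of `⟨P⟩`.
For any `0 ≤ i ≤ n`, if `C^{⟨0,…,i⟩} = [C_1, …, C_k]` is regular, then
`[C_1, prem(C_2, [C_1]), …, prem(C_k, [C_1, …, C_{k−1}])]` is a Ritt characteristic set
of the elimination ideal `⟨P⟩ ∩ k[x_1, …, x_i]`. -/
theorem statement12 {n : ℕ} {K : Type*} [Field K]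
    (P : Finset (MvPolynomial (Fin n) K)) (hne : P.Nonempty) (h0 : ∀ p ∈ P, p ≠ 0)
    (hproper : Ideal.span (P : Set (MvPolynomial (Fin n) K)) ≠ ⊤)
    (Cs : List (MvPolynomial (Fin n) K))
    (hW : IsWCharSet (Ideal.span (P : Set (MvPolynomial (Fin n) K))) Cs) :
    ∀ i : ℕ, ∀ hi : i ≤ n, ∀ D : List (MvPolynomial (Fin i) K),
      D.map (MvPolynomial.rename (Fin.castLE hi)) = Cs.filter (fun c => cls c ≤ i) →
      RegularSet D →
      RittCharSet
        (Ideal.comap (MvPolynomial.rename (Fin.castLE hi)).toRingHom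
          (Ideal.span (P : Set (MvPolynomial (Fin n) K))))
        (D.mapIdx fun j c => premTS c (D.take j)) := by
  intro i hi D hDC hD
  set I := Ideal.span (P : Set (MvPolynomial (Fin n) K))
  have hinj := Fin.castLE_injective hi
  have hIi : I.comap (rename (Fin.castLE hi)).toRingHom ≠ ⊤ := Ideal.comap_ne_top _ hproper
  have hDmem : ∀ c ∈ D, c ∈ I.comap (rename (Fin.castLE hi)).toRingHom := by
    intro c hc
    obtain ⟨G, hG, -, hCG, -⟩ := hW
    have h : rename (Fin.castLE hi) c ∈ Cs.filter (fun c => cls c ≤ i) :=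
      hDC ▸ List.mem_map_of_mem hc
    exact (hG.1 _ (hCG _ (List.mem_filter.1 h).1)).1
  refine rittCharSet_of_no_reduced hIi hD.ascendingSet_premTS ?_ fun b hb hb0 => ?_
  · intro a ha
    obtain ⟨k, hk, rfl⟩ := List.getElem_of_mem ha
    rw [List.getElem_mapIdx]
    exact premTS_mem (hDmem _ (List.getElem_mem _)) fun T hT => hDmem T (List.mem_of_mem_take hT)
  · obtain ⟨c, hc, p, hp, hle⟩ := hW.exists_degreeOf_le hproper (b := rename (Fin.castLE hi) b) hb
      ((map_ne_zero_iff _ (rename_injective _ hinj)).2 hb0)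
    obtain ⟨q, rfl⟩ := exists_castLE_of_degreeOf_rename_pos hi (hp.1.trans_le hle)
    have hcf : c ∈ D.map (rename (Fin.castLE hi)) := by
      rw [hDC, List.mem_filter]
      refine ⟨hc, decide_eq_true ?_⟩
      rw [hp.cls_eq]
      exact q.2
    obtain ⟨d, hd, rfl⟩ := List.mem_map.1 hcf
    obtain ⟨l, hl, rfl⟩ := List.getElem_of_mem hd
    have hq := isLeadVar_of_rename hi hp
    rw [degreeOf_rename_of_injective hinj, degreeOf_rename_of_injective hinj] at hle
    refine ⟨l, by rwa [List.length_mapIdx], q, ?_⟩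
    rw [List.getElem_mapIdx, hD.degreeOf_premTS hl hq]
    exact ⟨hD.isLeadVar_premTS hl hq, hle⟩

end CharSets
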